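/- For every Schwartz function U : ℝ³ → ℂ and every r ∈ ℝ³, the first moment of the Wigner distribution recovers the energy current: (2π)^{−3} ∫_{ℝ³} k W(r,k) dk = (1/(2i)) ( conj(U) ∇U − U ∇conj(U) )(r), i.e., it equals Im( conj(U(r)) ∇U(r) ) componentwise (which is k₀ times the energy current density J = (1/(2ik₀))(Ū∇U − U∇Ū)). -/

import Mathlib

open MeasureTheory Complex
open scoped RealInnerProductSpace

noncomputable section

abbrev E3 : Type := EuclideanSpace ℝ (Fin 3)

/-- The Wigner distribution
`W(r,k) = ∫ e^{i k·R} U(r - R/2) conj(U(r + R/2)) dR` of a Schwartz function `U`. -/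
def wigner (U : SchwartzMap E3 ℂ) (r k : E3) : ℂ :=
  ∫ R : E3, Complex.exp (Complex.I * ((⟪k, R⟫ : ℝ) : ℂ)) *
    (U (r - (1 / 2 : ℝ) • R) * (starRingEnd ℂ) (U (r + (1 / 2 : ℝ) • R)))

open FourierTransform LineDeriv in
/-- The first moment of the inverse Fourier transform in the direction `m` is `i / (2π)` times the
derivative of the original function at the origin. -/
theorem integral_inner_mul_fourierInv {V : Type*} [NormedAddCommGroup V] [InnerProductSpace ℝ V]
    [FiniteDimensional ℝ V] [MeasurableSpace V] [BorelSpace V] (f : SchwartzMap V ℂ) (m : V) :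
    ∫ ξ : V, ((⟪ξ, m⟫ : ℝ) : ℂ) * 𝓕⁻ (⇑f) ξ =
      Complex.I / (2 * Real.pi) * fderiv ℝ (⇑f) 0 m := by
  have hinv : 𝓕 (𝓕⁻ (∂_{m} f)) = ∂_{m} f := FourierTransform.fourier_fourierInv_eq _
  have h0 : (𝓕 (𝓕⁻ (∂_{m} f)) : SchwartzMap V ℂ) 0 = (∂_{m} f) 0 := by rw [hinv]
  have hg : (inner ℝ · m : V → ℝ).HasTemperateGrowth := by fun_prop
  rw [SchwartzMap.fourierInv_lineDerivOp_eq, SchwartzMap.fourier_coe, Real.fourier_eq,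
    SchwartzMap.lineDerivOp_apply_eq_fderiv] at h0
  simp only [inner_zero_right, neg_zero, AddChar.map_zero_eq_one, one_smul, smul_apply,
    SchwartzMap.smulLeftCLM_apply_apply hg, Complex.real_smul, smul_eq_mul,
    SchwartzMap.fourierInv_coe, integral_const_mul] at h0
  rw [← h0]
  have hpi : (Real.pi : ℂ) ≠ 0 := by exact_mod_cast Real.pi_ne_zero
  field_simp
  simp

/-- The function `R ↦ f (r + c • R)` with `c ≠ 0`, as a Schwartz function. -/
def SchwartzMap.compAffine {V : Type*} [NormedAddCommGroup V] [NormedSpace ℝ V]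
    (f : SchwartzMap V ℂ) (r : V) (c : ℝ) (hc : c ≠ 0) : SchwartzMap V ℂ :=
  SchwartzMap.compCLMOfContinuousLinearEquiv ℝ
    (ContinuousLinearEquiv.smulLeft (R₁ := ℝ) (Units.mk0 c hc))
    (SchwartzMap.compSubConstCLM ℝ (-r) f)

theorem SchwartzMap.compAffine_apply {V : Type*} [NormedAddCommGroup V] [NormedSpace ℝ V]
    (f : SchwartzMap V ℂ) (r : V) (c : ℝ) (hc : c ≠ 0) (R : V) :
    f.compAffine r c hc R = f (r + c • R) := by
  change f (c • R - -r) = _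
  rw [sub_neg_eq_add, add_comm]

/-- The two-point correlation `R ↦ U(r - R/2) conj(U(r + R/2))` as a Schwartz function. -/
def wignerCorrelation (U : SchwartzMap E3 ℂ) (r : E3) : SchwartzMap E3 ℂ :=
  SchwartzMap.pairing (ContinuousLinearMap.mul ℝ ℂ)
    (U.compAffine r (-(1 / 2)) (by norm_num))
    (SchwartzMap.postcompCLM (𝕜 := ℝ) (Complex.conjCLE : ℂ →L[ℝ] ℂ)
      (U.compAffine r (1 / 2) (by norm_num)))

theorem wignerCorrelation_apply (U : SchwartzMap E3 ℂ) (r R : E3) :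
    wignerCorrelation U r R =
      U (r - (1 / 2 : ℝ) • R) * (starRingEnd ℂ) (U (r + (1 / 2 : ℝ) • R)) := by
  simp [wignerCorrelation, SchwartzMap.compAffine_apply, sub_eq_add_neg]

open FourierTransform in
theorem wigner_eq_fourierInv (U : SchwartzMap E3 ℂ) (r k : E3) :
    wigner U r k = 𝓕⁻ (⇑(wignerCorrelation U r)) ((2 * Real.pi)⁻¹ • k) := by
  rw [Real.fourierInv_eq', wigner]
  congr 1 with R
  rw [wignerCorrelation_apply, smul_eq_mul, inner_smul_right, real_inner_comm,
    mul_inv_cancel_left₀ (by positivity), mul_comm Complex.I]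

theorem fderiv_wignerCorrelation_zero (U : SchwartzMap E3 ℂ) (r m : E3) :
    fderiv ℝ (⇑(wignerCorrelation U r)) 0 m =
      (1 / 2) * (U r * (starRingEnd ℂ) (fderiv ℝ (⇑U) r m) -
        (starRingEnd ℂ) (U r) * fderiv ℝ (⇑U) r m) := by
  have hU (c : ℝ) : HasFDerivAt (fun R : E3 => U (r + c • R))
      ((fderiv ℝ (⇑U) r).comp (c • ContinuousLinearMap.id ℝ E3)) 0 := by
    have h : HasFDerivAt (⇑U) (fderiv ℝ (⇑U) r) (r + c • (0 : E3)) := by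
      simpa using U.differentiableAt.hasFDerivAt
    exact h.comp (0 : E3) (((hasFDerivAt_id (0 : E3)).const_smul c).const_add r)
  have hconj := Complex.conjCLE.hasFDerivAt.comp (0 : E3) (hU (1 / 2))
  have h := (hU (-(1 / 2))).mul hconj
  have heq : (⇑(wignerCorrelation U r)) =
      (fun R : E3 => U (r + (-(1 / 2) : ℝ) • R)) *
        (⇑Complex.conjCLE ∘ fun R : E3 => U (r + (1 / 2 : ℝ) • R)) := by
    ext R
    simp [wignerCorrelation_apply, sub_eq_add_neg]
  rw [heq, h.fderiv]
  simp
  ring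

theorem integral_coord_mul_wigner (U : SchwartzMap E3 ℂ) (r : E3) (i : Fin 3) :
    ∫ k : E3, ((k i : ℝ) : ℂ) * wigner U r k =
      (((2 * Real.pi) ^ 3 : ℝ) : ℂ) * (Complex.I *
        fderiv ℝ (⇑(wignerCorrelation U r)) 0 (EuclideanSpace.single i 1)) := by
  have hpi : (Real.pi : ℂ) ≠ 0 := by exact_mod_cast Real.pi_ne_zero
  have hmoment := integral_inner_mul_fourierInv (wignerCorrelation U r)
    (EuclideanSpace.single i (1 : ℝ))
  have hscale := Measure.integral_comp_inv_smul_of_nonneg (volume : Measure E3)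
    (fun ξ : E3 => ((⟪ξ, EuclideanSpace.single i (1 : ℝ)⟫ : ℝ) : ℂ) *
      FourierTransformInv.fourierInv (⇑(wignerCorrelation U r)) ξ)
    (R := 2 * Real.pi) (by positivity)
  rw [hmoment, finrank_euclideanSpace_fin] at hscale
  have hint : ∀ k : E3, ((k i : ℝ) : ℂ) * wigner U r k = (2 * Real.pi : ℂ) *
      (((⟪(2 * Real.pi)⁻¹ • k, EuclideanSpace.single i (1 : ℝ)⟫ : ℝ) : ℂ) *
        FourierTransformInv.fourierInv (⇑(wignerCorrelation U r)) ((2 * Real.pi)⁻¹ • k)) := by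
    intro k
    rw [wigner_eq_fourierInv, real_inner_smul_left, EuclideanSpace.inner_single_right]
    push_cast
    simp only [conj_trivial, one_mul]
    field_simp
  simp_rw [hint]
  rw [integral_const_mul, hscale, Complex.real_smul]
  field_simp

/-- **The first moment of the Wigner distribution recovers the energy current**:
componentwise, `(2π)⁻³ ∫ kᵢ W(r,k) dk = (1/(2i))(conj(U)∂ᵢU - U ∂ᵢconj(U))(r)
= Im(conj(U(r)) ∂ᵢU(r))` (which is `k₀` times the energy current density `J`). -/
theorem wigner_first_moment (U : SchwartzMap E3 ℂ) (r : E3) (i : Fin 3) :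
    ((((2 * Real.pi) ^ 3)⁻¹ : ℝ) : ℂ) * (∫ k : E3, ((k i : ℝ) : ℂ) * wigner U r k) =
      ((starRingEnd ℂ) (U r) * fderiv ℝ (⇑U) r (EuclideanSpace.single i 1) -
          U r * (starRingEnd ℂ) (fderiv ℝ (⇑U) r (EuclideanSpace.single i 1))) /
        (2 * Complex.I) ∧
    ((((2 * Real.pi) ^ 3)⁻¹ : ℝ) : ℂ) * (∫ k : E3, ((k i : ℝ) : ℂ) * wigner U r k) =
      ((((starRingEnd ℂ) (U r) * fderiv ℝ (⇑U) r (EuclideanSpace.single i 1)).im : ℝ) : ℂ) := by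
  have hpi : (((2 * Real.pi) ^ 3 : ℝ) : ℂ) ≠ 0 := by
    exact_mod_cast (by positivity : ((2 * Real.pi) ^ 3 : ℝ) ≠ 0)
  have hcurrent : ((((2 * Real.pi) ^ 3)⁻¹ : ℝ) : ℂ) *
      (∫ k : E3, ((k i : ℝ) : ℂ) * wigner U r k) =
      ((starRingEnd ℂ) (U r) * fderiv ℝ (⇑U) r (EuclideanSpace.single i 1) -
          U r * (starRingEnd ℂ) (fderiv ℝ (⇑U) r (EuclideanSpace.single i 1))) /
        (2 * Complex.I) := by
    rw [integral_coord_mul_wigner, Complex.ofReal_inv, inv_mul_cancel_left₀ hpi,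
      fderiv_wignerCorrelation_zero, eq_div_iff (by simp)]
    linear_combination (U r * (starRingEnd ℂ) (fderiv ℝ (⇑U) r (EuclideanSpace.single i 1)) -
      (starRingEnd ℂ) (U r) * fderiv ℝ (⇑U) r (EuclideanSpace.single i 1)) * Complex.I_sq
  refine ⟨hcurrent, hcurrent.trans ?_⟩
  rw [Complex.im_eq_sub_conj]
  simp

end
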